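/- arXiv:1809.02826 — 5 statements merged into one kernel-verified Lean document; each statement's English description precedes it below -/
import Mathlib

section
/- For any positive integers N and k, the set J_k of N×N doubly substochastic real matrices all of whose entries lie in the interval [0, 1/k] is exactly the convex hull of the finite set H_k of N×N doubly substochastic matrices all of whose entries are either 0 or 1/k. (Lemma 1) -/
open Matrix BigOperators

section CapacityGadget

variable {n : Type*} [Fintype n] [DecidableEq n] {k : ℕ}

/-- The doubly stochastic matrix encoding a doubly substochastic matrix `E` with entries at most
`1 / k`. Each index is split into `k` copies, and each position `e` of `E` contributes one
further row and one further column, which meet in the entry `1 - k * E e.1 e.2`. -/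
noncomputable def capacityMatrix (k : ℕ) (E : Matrix n n ℝ) :
    Matrix ((n × Fin k) ⊕ (n × n)) ((n × Fin k) ⊕ (n × n)) ℝ :=
  fromBlocks
    (of fun a b => (1 - ∑ j, E a.1 j) * (1 - ∑ i, E i b.1) / (k * ∑ i, (1 - ∑ j, E i j)))
    (of fun a e => if e.1 = a.1 then E e.1 e.2 else 0)
    (of fun e b => if e.2 = b.1 then E e.1 e.2 else 0)
    (diagonal fun e => 1 - k * E e.1 e.2)

lemma capacityMatrix_mem_doublyStochastic (hk : 0 < k) {E : Matrix n n ℝ}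
    (hE : ∀ i j, E i j ∈ Set.Icc (0 : ℝ) (1 / k))
    (hrow : ∀ i, ∑ j, E i j ≤ 1) (hcol : ∀ j, ∑ i, E i j ≤ 1) :
    capacityMatrix k E ∈ doublyStochastic ℝ ((n × Fin k) ⊕ (n × n)) := by
  have hk' : (0 : ℝ) < k := by exact_mod_cast hk
  have hr : ∀ i, 0 ≤ 1 - ∑ j, E i j := fun i => sub_nonneg.2 (hrow i)
  have hc : ∀ j, 0 ≤ 1 - ∑ i, E i j := fun j => sub_nonneg.2 (hcol j)
  have hT : ∑ j, (1 - ∑ i, E i j) = ∑ i, (1 - ∑ j, E i j) := by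
    rw [Finset.sum_sub_distrib, Finset.sum_sub_distrib, Finset.sum_comm]
  have hT0 : 0 ≤ ∑ i, (1 - ∑ j, E i j) := Finset.sum_nonneg fun i _ => hr i
  have cancel : ∀ x T : ℝ, (T = 0 → x = 0) → k * (x * T / (k * T)) = x := by
    intro x T h
    rcases eq_or_ne T 0 with h0 | h0
    · simp [h h0]
    · field_simp
  rw [mem_doublyStochastic_iff_sum]
  refine ⟨?_, ?_, ?_⟩
  · rintro (a | e) (b | f)
    · simp only [capacityMatrix, fromBlocks_apply₁₁, of_apply]
      exact div_nonneg (mul_nonneg (hr _) (hc _)) (mul_nonneg hk'.le hT0)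
    · simp only [capacityMatrix, fromBlocks_apply₁₂, of_apply]
      split_ifs
      exacts [(hE _ _).1, le_rfl]
    · simp only [capacityMatrix, fromBlocks_apply₂₁, of_apply]
      split_ifs
      exacts [(hE _ _).1, le_rfl]
    · simp only [capacityMatrix, fromBlocks_apply₂₂, diagonal_apply]
      split_ifs
      · have := (le_div_iff₀ hk').1 (hE e.1 e.2).2
        linarith
      · exact le_rfl
  · rintro (a | e)
    · have hz : ∑ i, (1 - ∑ j, E i j) = 0 → 1 - ∑ j, E a.1 j = 0 := fun h =>
        (Finset.sum_eq_zero_iff_of_nonneg fun i _ => hr i).1 h a.1 (Finset.mem_univ _)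
      have := cancel _ _ hz
      simp only [capacityMatrix, Fintype.sum_sum_type, Fintype.sum_prod_type, fromBlocks_apply₁₁,
        fromBlocks_apply₁₂, of_apply, Finset.sum_const, Finset.card_univ, Fintype.card_fin,
        nsmul_eq_mul]
      rw [← Finset.mul_sum, ← Finset.sum_div, ← Finset.mul_sum, hT, this, Finset.sum_comm]
      simp
    · simp only [capacityMatrix, Fintype.sum_sum_type, Fintype.sum_prod_type (α₁ := n) (α₂ := Fin k),
        fromBlocks_apply₂₁, fromBlocks_apply₂₂, of_apply, diagonal_apply]
      rw [Finset.sum_comm]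
      simp
  · rintro (b | f)
    · have hz : ∑ i, (1 - ∑ j, E i j) = 0 → 1 - ∑ i, E i b.1 = 0 := fun h =>
        (Finset.sum_eq_zero_iff_of_nonneg fun i _ => hc i).1 (hT.trans h) b.1 (Finset.mem_univ _)
      have := cancel _ _ hz
      simp only [capacityMatrix, Fintype.sum_sum_type, Fintype.sum_prod_type, fromBlocks_apply₁₁,
        fromBlocks_apply₂₁, of_apply, Finset.sum_const, Finset.card_univ, Fintype.card_fin,
        nsmul_eq_mul]
      rw [← Finset.mul_sum, ← Finset.sum_div, ← Finset.sum_mul, mul_comm (∑ i, _) (1 - _), this]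
      simp
    · simp only [capacityMatrix, Fintype.sum_sum_type, Fintype.sum_prod_type (α₁ := n) (α₂ := Fin k),
        fromBlocks_apply₁₂, fromBlocks_apply₂₂, of_apply, diagonal_apply]
      rw [Finset.sum_comm]
      simp

/-- If each `g i` violating `p` is sent by `τ` into the `k` copies of `a`, at most `k` indices violate `p`. -/
lemma sum_ite_inv_le_one {ι α β γ : Type*} [Fintype ι] (hk : 0 < k) (p : ι → Prop)
    [DecidablePred p] (g : ι → α) (hg : g.Injective) (τ : α → (β × Fin k) ⊕ γ)
    (hτ : τ.Injective) (a : β) (h : ∀ i, ¬ p i → ∃ c, τ (g i) = Sum.inl (a, c)) :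
    ∑ i, (if p i then (0 : ℝ) else 1 / k) ≤ 1 := by
  have hk' : (0 : ℝ) < k := by exact_mod_cast hk
  choose c hc using h
  have hcard : Fintype.card {i // ¬ p i} ≤ k := by
    rw [← Fintype.card_fin k]
    refine Fintype.card_le_of_injective (fun i => c i.1 i.2) fun i j hij => Subtype.ext ?_
    refine hg (hτ ?_)
    rw [hc _ i.2, hc _ j.2]
    simpa using hij
  rw [Fintype.card_subtype] at hcard
  rw [Finset.sum_ite, Finset.sum_const_zero, zero_add, Finset.sum_const, nsmul_eq_mul,
    mul_one_div, div_le_one hk']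
  exact_mod_cast hcard

end CapacityGadget

/-- For any positive integers `N` and `k`, the set `J_k` of `N×N` doubly
substochastic real matrices with all entries in `[0, 1/k]` is exactly the convex hull of the
set `H_k` of doubly substochastic matrices all of whose entries are `0` or `1/k`. -/
theorem dss_bounded_eq_convexHull (N k : ℕ) (hN : 0 < N) (hk : 0 < k) :
    {E : Matrix (Fin N) (Fin N) ℝ |
        (∀ i j, E i j ∈ Set.Icc (0 : ℝ) (1 / k)) ∧
        (∀ i, ∑ j, E i j ≤ 1) ∧ (∀ j, ∑ i, E i j ≤ 1)} =
      convexHull ℝ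
        {E : Matrix (Fin N) (Fin N) ℝ |
          (∀ i j, E i j = 0 ∨ E i j = 1 / k) ∧
          (∀ i, ∑ j, E i j ≤ 1) ∧ (∀ j, ∑ i, E i j ≤ 1)} := by
  have hk' : (0 : ℝ) < k := by exact_mod_cast hk
  apply Set.Subset.antisymm
  · rintro E ⟨hE, hrow, hcol⟩
    obtain ⟨w, hw0, hw1, hw⟩ := exists_eq_sum_perm_of_mem_doublyStochastic
      (capacityMatrix_mem_doublyStochastic hk hE hrow hcol)
    have happ : ∀ x y, ∑ σ, w σ * (if σ x = y then 1 else 0) = capacityMatrix k E x y := by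
      intro x y
      rw [← hw, Matrix.sum_apply]
      simp [Equiv.Perm.permMatrix, PEquiv.toMatrix_apply, eq_comm]
    have hsupp : ∀ σ, w σ ≠ 0 → ∀ x, capacityMatrix k E x (σ x) ≠ 0 := by
      intro σ hσ x h0
      rw [← happ, Finset.sum_eq_zero_iff_of_nonneg
        fun τ _ => mul_nonneg (hw0 τ) (by split_ifs <;> simp)] at h0
      exact hσ (by simpa using h0 σ (Finset.mem_univ _))
    let F : Equiv.Perm ((Fin N × Fin k) ⊕ (Fin N × Fin N)) → Matrix (Fin N) (Fin N) ℝ :=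
      fun σ => of fun i j => if σ (Sum.inr (i, j)) = Sum.inr (i, j) then 0 else 1 / k
    have hEF : E = ∑ σ with w σ ≠ 0, w σ • F σ := by
      rw [Finset.sum_filter_of_ne fun σ _ h => mt (fun h0 => by rw [h0, zero_smul]) h]
      ext i j
      have h := happ (Sum.inr (i, j)) (Sum.inr (i, j))
      simp only [capacityMatrix, fromBlocks_apply₂₂, diagonal_apply_eq] at h
      have hF : ∀ σ, w σ * F σ i j =
          (w σ - w σ * (if σ (Sum.inr (i, j)) = Sum.inr (i, j) then 1 else 0)) * (1 / k) := by
        intro σ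
        simp only [F, of_apply]
        split_ifs <;> ring
      simp only [Matrix.sum_apply, Matrix.smul_apply, smul_eq_mul, hF]
      rw [← Finset.sum_mul, Finset.sum_sub_distrib, h, hw1]
      field_simp
      ring
    rw [hEF]
    refine (convex_convexHull ℝ _).sum_mem (fun σ _ => hw0 σ)
      (by rw [Finset.sum_filter_ne_zero, hw1]) fun σ hσ => subset_convexHull ℝ _ ?_
    have hs := hsupp σ (Finset.mem_filter.1 hσ).2
    refine ⟨fun i j => ?_, fun i => ?_, fun j => ?_⟩
    · simp only [F, of_apply]
      split_ifs <;> simp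
    · refine sum_ite_inv_le_one hk _ (fun j => Sum.inr (i, j)) (fun _ _ h => by simpa using h)
        σ.symm σ.symm.injective i fun j hj => ?_
      have hx := hs (σ.symm (Sum.inr (i, j)))
      rw [Equiv.apply_symm_apply] at hx
      rcases hy : σ.symm (Sum.inr (i, j)) with ⟨a, c⟩ | e
      · rw [hy] at hx
        simp only [capacityMatrix, fromBlocks_apply₁₂, of_apply] at hx
        exact ⟨c, by rw [(ite_ne_right_iff.1 hx).1]⟩
      · rw [hy] at hx
        simp only [capacityMatrix, fromBlocks_apply₂₂, diagonal_apply] at hx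
        rw [(ite_ne_right_iff.1 hx).1, Equiv.symm_apply_eq] at hy
        exact absurd hy.symm hj
    · refine sum_ite_inv_le_one hk _ (fun i => Sum.inr (i, j)) (fun _ _ h => by simpa using h)
        σ σ.injective j fun i hi => ?_
      have hx := hs (Sum.inr (i, j))
      rcases hy : σ (Sum.inr (i, j)) with ⟨b, c⟩ | e
      · rw [hy] at hx
        simp only [capacityMatrix, fromBlocks_apply₂₁, of_apply] at hx
        exact ⟨c, by rw [(ite_ne_right_iff.1 hx).1]⟩
      · rw [hy] at hx
        simp only [capacityMatrix, fromBlocks_apply₂₂, diagonal_apply] at hx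
        rw [← (ite_ne_right_iff.1 hx).1] at hy
        exact absurd hy hi
  · refine convexHull_min ?_ ?_
    · rintro E ⟨hE, hrow, hcol⟩
      refine ⟨fun i j => ?_, hrow, hcol⟩
      rcases hE i j with h | h <;> rw [h] <;> constructor <;> first | exact le_rfl | positivity
    · rintro A ⟨hA, hAr, hAc⟩ B ⟨hB, hBr, hBc⟩ a b ha hb hab
      refine ⟨fun i j => convex_Icc (0 : ℝ) (1 / k) (hA i j) (hB i j) ha hb hab, fun i => ?_,
        fun j => ?_⟩
      · simpa [Finset.sum_add_distrib, Finset.mul_sum] using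
          convex_Iic (1 : ℝ) (hAr i) (hBr i) ha hb hab
      · simpa [Finset.sum_add_distrib, Finset.mul_sum] using
          convex_Iic (1 : ℝ) (hAc j) (hBc j) ha hb hab
end

section
/- Let N and T be positive integers. An N×N real matrix R = (R_{i,j}) satisfies the three families of constraints: (a) for every column j, the sum over i of R_{i,j} is at most 1; (b) for every row i, the sum over j of R_{i,j} is at most 1; and (c) every entry R_{i,j} lies in [0, 1/T], if and only if there exist a positive integer K, positive real numbers λ_1, …, λ_K summing to 1, and for each k ∈ {1,…,K} a family M_{k,1}, …, M_{k,T} of T pairwise disjoint N×N subpermutation matrices, such that T·R = Σ_{k=1}^{K} λ_k Σ_{t=1}^{T} M_{k,t}. (Combinatorial core of Theorem 2: characterization of the capacity region 𝓡(T) of the delay-constrained N×N input-queued switch with frame length T.) -/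
open Matrix BigOperators

/-- An `N×N` matrix is a subpermutation matrix if all its entries are `0` or `1` and each of
its rows and columns sums to at most `1`. -/
def IsSubpermutationMatrix {N : ℕ} (M : Matrix (Fin N) (Fin N) ℝ) : Prop :=
  (∀ i j, M i j = 0 ∨ M i j = 1) ∧
  (∀ i, ∑ j, M i j ≤ 1) ∧ (∀ j, ∑ i, M i j ≤ 1)

/-- Two `{0,1}` matrices are disjoint if there is no position where both have entry `1`. -/
def MatDisjoint {N : ℕ} (M M' : Matrix (Fin N) (Fin N) ℝ) : Prop :=
  ∀ i j, ¬(M i j = 1 ∧ M' i j = 1)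

/-- A doubly substochastic matrix `G` is a convex combination of the upper left corners of
permutation matrices of twice the size. The partial matchings of positive weight use only nonzero
entries of `G`, and cover every row and every column of `G` whose sum is `1`. -/
theorem exists_perm_weights_of_doublySubstochastic {n : Type*} [Fintype n] [DecidableEq n]
    (G : Matrix n n ℝ) (h0 : ∀ i j, 0 ≤ G i j) (hrow : ∀ i, ∑ j, G i j ≤ 1)
    (hcol : ∀ j, ∑ i, G i j ≤ 1) :
    ∃ (S : Finset (Equiv.Perm (n ⊕ n))) (w : Equiv.Perm (n ⊕ n) → ℝ),
      (∀ σ ∈ S, 0 < w σ) ∧ ∑ σ ∈ S, w σ = 1 ∧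
      (∀ i j, ∑ σ ∈ S, w σ * (if σ (Sum.inl i) = Sum.inl j then 1 else 0) = G i j) ∧
      ∀ σ ∈ S,
        (∀ i j, σ (Sum.inl i) = Sum.inl j → G i j ≠ 0) ∧
        (∀ i, ∑ j, G i j = 1 → ∃ j, σ (Sum.inl i) = Sum.inl j) ∧
        (∀ j, ∑ i, G i j = 1 → ∃ i, σ (Sum.inl i) = Sum.inl j) := by
  set B : Matrix (n ⊕ n) (n ⊕ n) ℝ := Matrix.fromBlocks G
    (Matrix.diagonal fun i => 1 - ∑ j, G i j) (Matrix.diagonal fun j => 1 - ∑ i, G i j) Gᵀ with hB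
  have hBmem : B ∈ doublyStochastic ℝ (n ⊕ n) := by
    rw [mem_doublyStochastic_iff_sum]
    refine ⟨?_, ?_, ?_⟩
    · rintro (i | i) (j | j)
      · simpa [hB] using h0 i j
      · by_cases h : i = j
        · subst h; simpa [hB] using hrow i
        · simp [hB, h]
      · by_cases h : i = j
        · subst h; simpa [hB] using hcol i
        · simp [hB, h]
      · simpa [hB] using h0 j i
    · rintro (i | i) <;> simp [hB, Matrix.diagonal_apply]
    · rintro (i | i) <;> simp [hB, Matrix.diagonal_apply]
  obtain ⟨w, hw0, hw1, hw⟩ := exists_eq_sum_perm_of_mem_doublyStochastic hBmem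
  have hent : ∀ x y, ∑ σ, w σ * (if σ x = y then 1 else 0) = B x y := by
    intro x y
    rw [← hw]
    simp [Matrix.sum_apply, PEquiv.toMatrix_apply, Equiv.toPEquiv_apply]
  have hsupp : ∀ σ, 0 < w σ → ∀ x y, σ x = y → B x y ≠ 0 := by
    intro σ hσ x y hxy
    rw [← hent]
    refine (hσ.trans_le ?_).ne'
    calc w σ = w σ * (if σ x = y then 1 else 0) := by simp [hxy]
      _ ≤ _ := Finset.single_le_sum (f := fun σ => w σ * (if σ x = y then (1 : ℝ) else 0))
        (fun τ _ => mul_nonneg (hw0 τ) (by split_ifs <;> norm_num)) (Finset.mem_univ σ)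
  have hpos : ∀ f : Equiv.Perm (n ⊕ n) → ℝ,
      ∑ σ ∈ Finset.univ.filter (fun σ => 0 < w σ), w σ * f σ = ∑ σ, w σ * f σ := by
    refine fun f => Finset.sum_subset (Finset.subset_univ _) fun σ _ hσ => ?_
    have hz : w σ = 0 := le_antisymm (by simpa using hσ) (hw0 σ)
    simp [hz]
  refine ⟨Finset.univ.filter fun σ => 0 < w σ, w, by simp, ?_,
    fun i j => (hpos _).trans (hent _ _), fun σ hσ => ?_⟩
  · simpa [hw1] using hpos fun _ => 1
  replace hσ : 0 < w σ := by simpa using hσ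
  refine ⟨fun i j h => hsupp σ hσ _ _ h, ?_, ?_⟩
  · intro i hi
    rcases h : σ (Sum.inl i) with j | j
    · exact ⟨j, rfl⟩
    · refine absurd ?_ (hsupp σ hσ _ _ h)
      by_cases hij : i = j
      · subst hij; simp [hB, hi]
      · simp [hB, hij]
  · intro j hj
    rcases h : σ.symm (Sum.inl j) with i | i
    · exact ⟨i, by rw [← h, Equiv.apply_symm_apply]⟩
    · refine absurd ?_ (hsupp σ hσ (Sum.inr i) (Sum.inl j) (by rw [← h, Equiv.apply_symm_apply]))
      by_cases hij : i = j
      · subst hij; simp [hB, hj]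
      · simp [hB, hij]

theorem sum_le_of_sum_lt_succ_of_zero_or_one {ι : Type*} [Fintype ι] {f : ι → ℝ} {T : ℕ}
    (hf : ∀ i, f i = 0 ∨ f i = 1) (h : ∑ i, f i < (T : ℝ) + 1) : ∑ i, f i ≤ T := by
  have hnat : ∀ i, ∃ k : ℕ, f i = k := fun i => by
    rcases hf i with h | h
    · exact ⟨0, by simp [h]⟩
    · exact ⟨1, by simp [h]⟩
  choose k hk using hnat
  simp only [hk] at h ⊢
  norm_cast at h ⊢
  omega

/-- A zero-one matrix whose row and column sums are at most `T` is the sum of `T` pairwise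
disjoint subpermutation matrices. -/
theorem exists_disjoint_subpermutation_sum {N : ℕ} (T : ℕ) (Y : Matrix (Fin N) (Fin N) ℝ)
    (hY : ∀ i j, Y i j = 0 ∨ Y i j = 1) (hrow : ∀ i, ∑ j, Y i j ≤ T)
    (hcol : ∀ j, ∑ i, Y i j ≤ T) :
    ∃ M : Fin T → Matrix (Fin N) (Fin N) ℝ, (∀ t, IsSubpermutationMatrix (M t)) ∧
      (∀ t t', t ≠ t' → MatDisjoint (M t) (M t')) ∧ Y = ∑ t, M t := by
  have hY0 : ∀ i j, 0 ≤ Y i j := fun i j => by rcases hY i j with h | h <;> simp [h]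
  induction T generalizing Y with
  | zero =>
    refine ⟨fun _ => 0, fun t => t.elim0, fun t => t.elim0, ?_⟩
    ext i j
    have h := (Finset.single_le_sum (fun j _ => hY0 i j) (Finset.mem_univ j)).trans (hrow i)
    simpa using le_antisymm (by simpa using h) (hY0 i j)
  | succ T ih =>
    have hT : (0 : ℝ) < (T : ℝ) + 1 := by positivity
    push_cast at hrow hcol
    obtain ⟨S, w, -, hw1, -, hw⟩ := exists_perm_weights_of_doublySubstochastic
      (fun i j => Y i j / ((T : ℝ) + 1)) (fun i j => div_nonneg (hY0 i j) hT.le)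
      (fun i => by rw [← Finset.sum_div, div_le_one hT]; exact hrow i)
      (fun j => by rw [← Finset.sum_div, div_le_one hT]; exact hcol j)
    obtain ⟨σ, hσ⟩ : S.Nonempty := Finset.nonempty_of_sum_ne_zero (by rw [hw1]; exact one_ne_zero)
    obtain ⟨hsupp, hr, hc⟩ := hw σ hσ
    simp only [← Finset.sum_div, div_eq_one_iff_eq hT.ne'] at hr hc
    set P : Matrix (Fin N) (Fin N) ℝ :=
      fun i j => if σ (Sum.inl i) = Sum.inl j then 1 else 0 with hP
    have hPY : ∀ i j, P i j = 1 → Y i j = 1 := by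
      intro i j h
      have h' : σ (Sum.inl i) = Sum.inl j := by
        by_contra hne
        simp [hP, hne] at h
      exact (hY i j).resolve_left fun h0 => hsupp i j h' (by simp [h0])
    have hP01 : ∀ i j, P i j = 0 ∨ P i j = 1 := fun i j => by
      simp only [hP]; split_ifs <;> simp
    have hProw : ∀ i j, σ (Sum.inl i) = Sum.inl j → ∑ j, P i j = 1 := by
      intro i j h
      simp [hP, h]
    have hPcol : ∀ i j, σ (Sum.inl i) = Sum.inl j → ∑ i, P i j = 1 := by
      intro i j h
      simp [hP, ← h]
    have hProw' : ∀ i, ∑ j, P i j = 0 ∨ ∑ j, P i j = 1 := by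
      intro i
      by_cases h : ∃ j, σ (Sum.inl i) = Sum.inl j
      · exact .inr (hProw i _ h.choose_spec)
      · push Not at h
        simp [hP, h]
    have hPcol' : ∀ j, ∑ i, P i j = 0 ∨ ∑ i, P i j = 1 := by
      intro j
      by_cases h : ∃ i, σ (Sum.inl i) = Sum.inl j
      · exact .inr (hPcol _ j h.choose_spec)
      · push Not at h
        simp [hP, h]
    have hPsub : IsSubpermutationMatrix P :=
      ⟨hP01, fun i => by rcases hProw' i with h | h <;> simp [h],
        fun j => by rcases hPcol' j with h | h <;> simp [h]⟩
    have hZ : ∀ i j, (Y - P) i j = 0 ∨ (Y - P) i j = 1 := by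
      intro i j
      rcases hP01 i j with h | h
      · simpa [h] using hY i j
      · simp [h, hPY i j h]
    have hZ0 : ∀ i j, 0 ≤ (Y - P) i j := fun i j => by rcases hZ i j with h | h <;> simp [h]
    obtain ⟨M, hM, hMd, hMs⟩ := ih (Y - P) hZ
      (fun i => by
        simp only [Matrix.sub_apply, Finset.sum_sub_distrib]
        rcases hProw' i with h | h
        · have hlt := (hrow i).lt_of_ne fun he => by
            obtain ⟨j, hj⟩ := hr i he
            linarith [hProw i j hj]
          simpa [h] using sum_le_of_sum_lt_succ_of_zero_or_one (hY i) hlt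
        · linarith [hrow i])
      (fun j => by
        simp only [Matrix.sub_apply, Finset.sum_sub_distrib]
        rcases hPcol' j with h | h
        · have hlt := (hcol j).lt_of_ne fun he => by
            obtain ⟨i, hi⟩ := hc j he
            linarith [hPcol i j hi]
          simpa [h] using sum_le_of_sum_lt_succ_of_zero_or_one (fun i => hY i j) hlt
        · linarith [hcol j])
      hZ0
    have hPM : ∀ t i j, P i j = 1 → M t i j ≠ 1 := by
      intro t i j h h'
      have hle := Finset.single_le_sum (f := fun t => M t i j)
        (fun t _ => by rcases (hM t).1 i j with h | h <;> simp [h]) (Finset.mem_univ t)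
      have hs := congrFun (congrFun hMs i) j
      simp only [Matrix.sub_apply, Matrix.sum_apply, h, hPY i j h, sub_self] at hs
      simp only [← hs, h'] at hle
      linarith
    refine ⟨Fin.cons P M, ?_, ?_, ?_⟩
    · intro t
      cases t using Fin.cases with
      | zero => exact hPsub
      | succ t => exact hM t
    · intro t t' htt'
      cases t using Fin.cases with
      | zero =>
        cases t' using Fin.cases with
        | zero => exact absurd rfl htt'
        | succ t' => exact fun i j h => hPM t' i j h.1 h.2
      | succ t =>
        cases t' using Fin.cases with
        | zero => exact fun i j h => hPM t i j h.2 h.1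
        | succ t' => exact hMd t t' fun h => htt' (congrArg Fin.succ h)
    · rw [Fin.sum_univ_succ]
      simp [← hMs]

/-- The vertices on either side of the bipartite graph behind `gadgetMatrix`: `T` copies of each
row (or column), and one vertex for each matrix position. -/
abbrev GadgetVertex (N T : ℕ) : Type := (Fin N × Fin T) ⊕ (Fin N × Fin N)

/-- The matrix that encodes a capacitated transportation problem with data `X` as an assignment
problem. -/
noncomputable def gadgetMatrix {N : ℕ} (T : ℕ) (X : Matrix (Fin N) (Fin N) ℝ) :
    Matrix (GadgetVertex N T) (GadgetVertex N T) ℝ :=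
  Matrix.fromBlocks 0
    (Matrix.of fun p e => if p.1 = e.1 then X e.1 e.2 / T else 0)
    (Matrix.of fun e p => if p.1 = e.2 then X e.1 e.2 / T else 0)
    (Matrix.diagonal fun e => 1 - X e.1 e.2)

/-- The transportation polytope with entries in `[0, 1]` and with row and column sums at most `T`
is integral: its members are convex combinations of zero-one matrices satisfying the same
constraints. -/
theorem exists_zero_one_convex_combination {N T : ℕ} (hT : 0 < T) (X : Matrix (Fin N) (Fin N) ℝ)
    (h0 : ∀ i j, 0 ≤ X i j) (h1 : ∀ i j, X i j ≤ 1) (hrow : ∀ i, ∑ j, X i j ≤ T)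
    (hcol : ∀ j, ∑ i, X i j ≤ T) :
    ∃ (ι : Type) (_ : Fintype ι) (w : ι → ℝ) (Y : ι → Matrix (Fin N) (Fin N) ℝ),
      (∀ k, 0 < w k) ∧ ∑ k, w k = 1 ∧ (∀ k i j, Y k i j = 0 ∨ Y k i j = 1) ∧
      (∀ k i, ∑ j, Y k i j ≤ T) ∧ (∀ k j, ∑ i, Y k i j ≤ T) ∧ X = ∑ k, w k • Y k := by
  have hT' : (0 : ℝ) < T := by exact_mod_cast hT
  have : Nonempty (Fin T) := ⟨⟨0, hT⟩⟩
  set G := gadgetMatrix T X with hG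
  have hG0 : ∀ x y, 0 ≤ G x y := by
    rintro (p | e) (q | f)
    · simp [hG, gadgetMatrix]
    · simp only [hG, gadgetMatrix, Matrix.of_apply, Matrix.fromBlocks_apply₁₂]
      split_ifs
      exacts [div_nonneg (h0 _ _) hT'.le, le_rfl]
    · simp only [hG, gadgetMatrix, Matrix.of_apply, Matrix.fromBlocks_apply₂₁]
      split_ifs
      exacts [div_nonneg (h0 _ _) hT'.le, le_rfl]
    · simp only [hG, gadgetMatrix, Matrix.fromBlocks_apply₂₂, Matrix.diagonal_apply]
      split_ifs
      exacts [sub_nonneg.2 (h1 _ _), le_rfl]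
  have hGrow : ∀ e, ∑ y, G (Sum.inr e) y = 1 := by
    intro e
    simp [hG, gadgetMatrix, Matrix.diagonal_apply, Fintype.sum_prod_type_right,
      mul_div_cancel₀ _ hT'.ne']
  have hGcol : ∀ e, ∑ x, G x (Sum.inr e) = 1 := by
    intro e
    simp [hG, gadgetMatrix, Matrix.diagonal_apply, Fintype.sum_prod_type_right,
      mul_div_cancel₀ _ hT'.ne']
  have hGrow' : ∀ p, ∑ y, G (Sum.inl p) y ≤ 1 := by
    intro p
    simp only [hG, gadgetMatrix, Matrix.of_apply, Fintype.sum_sum_type,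
      Matrix.fromBlocks_apply₁₁, Matrix.fromBlocks_apply₁₂,
      Matrix.zero_apply, Finset.sum_const_zero, zero_add, Fintype.sum_prod_type]
    rw [Finset.sum_comm]
    simpa [← Finset.sum_div, div_le_one hT'] using hrow p.1
  have hGcol' : ∀ p, ∑ x, G x (Sum.inl p) ≤ 1 := by
    intro p
    simp only [hG, gadgetMatrix, Matrix.of_apply, Fintype.sum_sum_type,
      Matrix.fromBlocks_apply₁₁, Matrix.fromBlocks_apply₂₁,
      Matrix.zero_apply, Finset.sum_const_zero, zero_add, Fintype.sum_prod_type]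
    simpa [← Finset.sum_div, div_le_one hT'] using hcol p.1
  obtain ⟨S, w, hw0, hw1, hwG, hw⟩ := exists_perm_weights_of_doublySubstochastic G hG0
    (by rintro (p | e); exacts [hGrow' p, (hGrow e).le])
    (by rintro (p | e); exacts [hGcol' p, (hGcol e).le])
  let Y : Equiv.Perm (GadgetVertex N T ⊕ GadgetVertex N T) → Matrix (Fin N) (Fin N) ℝ :=
    fun σ i j =>
      if σ (Sum.inl (Sum.inr (i, j))) = Sum.inl (Sum.inr (i, j)) then 0 else 1
  refine ⟨S, inferInstance, fun k => w k, fun k => Y k, fun k => hw0 k k.2, ?_, ?_, ?_, ?_, ?_⟩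
  · rwa [Finset.sum_coe_sort S w]
  · intro k i j
    simp only [Y]
    split_ifs <;> simp
  · rintro ⟨σ, hσ⟩ i
    obtain ⟨hsupp, -, hc⟩ := hw σ hσ
    have hex : ∀ j, σ (Sum.inl (Sum.inr (i, j))) ≠ Sum.inl (Sum.inr (i, j)) →
        ∃ a, σ (Sum.inl (Sum.inl (i, a))) = Sum.inl (Sum.inr (i, j)) := by
      intro j hj
      obtain ⟨⟨i', a⟩ | e, hx⟩ := hc (Sum.inr (i, j)) (hGcol _)
      · have := hsupp _ _ hx
        simp only [hG, gadgetMatrix, Matrix.of_apply, Matrix.fromBlocks_apply₁₂,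
          ne_eq, ite_eq_right_iff, not_forall] at this
        obtain ⟨rfl, -⟩ := this
        exact ⟨a, hx⟩
      · have := hsupp _ _ hx
        simp only [hG, gadgetMatrix, Matrix.fromBlocks_apply₂₂, Matrix.diagonal_apply, ne_eq,
          ite_eq_right_iff, not_forall] at this
        obtain ⟨rfl, -⟩ := this
        exact absurd hx hj
    choose! a ha using hex
    have hcard : (Finset.univ.filter fun j => ¬ σ (Sum.inl (Sum.inr (i, j))) =
        Sum.inl (Sum.inr (i, j))).card ≤ (Finset.univ : Finset (Fin T)).card := by
      refine Finset.card_le_card_of_injOn a (fun _ _ => Finset.mem_coe.2 (Finset.mem_univ _)) ?_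
      intro j hj j' hj' hjj'
      have h := ha j (by simpa using hj)
      rw [hjj', ha j' (by simpa using hj')] at h
      simpa using h.symm
    have hYsum : ∑ j, Y σ i j = ((Finset.univ.filter fun j =>
        ¬ σ (Sum.inl (Sum.inr (i, j))) = Sum.inl (Sum.inr (i, j))).card : ℝ) := by
      rw [Finset.card_filter]
      push_cast
      exact Finset.sum_congr rfl fun j _ => by simp only [Y, ite_not]
    rw [hYsum]
    exact_mod_cast hcard.trans_eq (by simp)
  · rintro ⟨σ, hσ⟩ j
    obtain ⟨hsupp, hr, -⟩ := hw σ hσ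
    have hex : ∀ i, σ (Sum.inl (Sum.inr (i, j))) ≠ Sum.inl (Sum.inr (i, j)) →
        ∃ b, σ (Sum.inl (Sum.inr (i, j))) = Sum.inl (Sum.inl (j, b)) := by
      intro i hi
      obtain ⟨⟨j', b⟩ | e, hx⟩ := hr (Sum.inr (i, j)) (hGrow _)
      · have := hsupp _ _ hx
        simp only [hG, gadgetMatrix, Matrix.of_apply, Matrix.fromBlocks_apply₂₁,
          ne_eq, ite_eq_right_iff, not_forall] at this
        obtain ⟨rfl, -⟩ := this
        exact ⟨b, hx⟩
      · have := hsupp _ _ hx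
        simp only [hG, gadgetMatrix, Matrix.fromBlocks_apply₂₂, Matrix.diagonal_apply, ne_eq,
          ite_eq_right_iff, not_forall] at this
        obtain ⟨rfl, -⟩ := this
        exact absurd hx hi
    choose! b hb using hex
    have hcard : (Finset.univ.filter fun i => ¬ σ (Sum.inl (Sum.inr (i, j))) =
        Sum.inl (Sum.inr (i, j))).card ≤ (Finset.univ : Finset (Fin T)).card := by
      refine Finset.card_le_card_of_injOn b (fun _ _ => Finset.mem_coe.2 (Finset.mem_univ _)) ?_
      intro i hi i' hi' hii'
      have h := hb i (by simpa using hi)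
      rw [hii', ← hb i' (by simpa using hi')] at h
      simpa using σ.injective h
    have hYsum : ∑ i, Y σ i j = ((Finset.univ.filter fun i =>
        ¬ σ (Sum.inl (Sum.inr (i, j))) = Sum.inl (Sum.inr (i, j))).card : ℝ) := by
      rw [Finset.card_filter]
      push_cast
      exact Finset.sum_congr rfl fun i _ => by simp only [Y, ite_not]
    rw [hYsum]
    exact_mod_cast hcard.trans_eq (by simp)
  · ext i j
    have hY : ∀ σ, w σ * Y σ i j = w σ - w σ * (if σ (Sum.inl (Sum.inr (i, j))) =
        Sum.inl (Sum.inr (i, j)) then 1 else 0) := by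
      intro σ
      simp only [Y]
      split_ifs <;> simp
    rw [Finset.sum_coe_sort S fun σ => w σ • Y σ]
    simp only [Matrix.sum_apply, Matrix.smul_apply, smul_eq_mul, hY, Finset.sum_sub_distrib, hw1,
      hwG]
    simp [hG, gadgetMatrix]

/-- combinatorial core of Theorem 2: an `N×N` real matrix `R` satisfies
(a) all column sums `≤ 1`, (b) all row sums `≤ 1`, and (c) all entries in `[0, 1/T]`,
if and only if there exist `K ≥ 1`, positive reals `λ_1, …, λ_K` summing to `1`, and for
each `k` a family of `T` pairwise disjoint subpermutation matrices `M_{k,1}, …, M_{k,T}`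
such that `T·R = Σ_k λ_k Σ_t M_{k,t}`. -/
theorem capacity_region_characterization (N T : ℕ) (hN : 0 < N) (hT : 0 < T)
    (R : Matrix (Fin N) (Fin N) ℝ) :
    ((∀ j, ∑ i, R i j ≤ 1) ∧ (∀ i, ∑ j, R i j ≤ 1) ∧
      (∀ i j, R i j ∈ Set.Icc (0 : ℝ) (1 / T))) ↔
    (∃ K : ℕ, 0 < K ∧
      ∃ lam : Fin K → ℝ, (∀ k, 0 < lam k) ∧ (∑ k, lam k = 1) ∧
        ∃ M : Fin K → Fin T → Matrix (Fin N) (Fin N) ℝ,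
          (∀ k t, IsSubpermutationMatrix (M k t)) ∧
          (∀ k, ∀ t t', t ≠ t' → MatDisjoint (M k t) (M k t')) ∧
          (T : ℝ) • R = ∑ k, lam k • (∑ t, M k t)) := by
  have hT' : (0 : ℝ) < T := by exact_mod_cast hT
  constructor
  · rintro ⟨hcol, hrow, hbox⟩
    obtain ⟨ι, _, w, Y, hw0, hw1, hY, hYr, hYc, hX⟩ := exists_zero_one_convex_combination hT
      ((T : ℝ) • R) (fun i j => mul_nonneg hT'.le (hbox i j).1)
      (fun i j => by simpa [mul_comm] using (le_div_iff₀ hT').1 (hbox i j).2)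
      (fun i => by
        simpa [← Finset.mul_sum] using mul_le_mul_of_nonneg_left (hrow i) hT'.le)
      (fun j => by
        simpa [← Finset.mul_sum] using mul_le_mul_of_nonneg_left (hcol j) hT'.le)
    choose M hM hMd hMs using fun k =>
      exists_disjoint_subpermutation_sum T (Y k) (hY k) (hYr k) (hYc k)
    have hne : Nonempty ι := by
      by_contra h
      rw [not_nonempty_iff] at h
      simp at hw1
    let e := (Fintype.equivFin ι).symm
    refine ⟨Fintype.card ι, Fintype.card_pos, w ∘ e, fun k => hw0 _, ?_, fun k => M (e k),
      fun k => hM _, fun k => hMd _, ?_⟩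
    · rw [← hw1]
      exact Equiv.sum_comp e w
    · simp only [hX, Function.comp_apply, ← hMs]
      exact (Equiv.sum_comp e fun k => w k • Y k).symm
  · rintro ⟨K, -, lam, hlam0, hlam1, M, hM, hMd, hR⟩
    have hent : ∀ i j, (T : ℝ) * R i j = ∑ k, lam k * ∑ t, M k t i j := by
      intro i j
      have := congrFun (congrFun hR i) j
      simpa [Matrix.sum_apply] using this
    have hM0 : ∀ k t i j, 0 ≤ M k t i j := fun k t i j => by
      rcases (hM k t).1 i j with h | h <;> simp [h]
    have hM1 : ∀ k i j, ∑ t, M k t i j ≤ 1 := by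
      intro k i j
      by_cases h : ∃ t, M k t i j = 1
      · obtain ⟨t, ht⟩ := h
        rw [Finset.sum_eq_single t
          (fun t' _ hne => ((hM k t').1 i j).resolve_right fun h' => hMd k t' t hne i j ⟨h', ht⟩)
          (by simp), ht]
      · push Not at h
        simp [fun t => ((hM k t).1 i j).resolve_right (h t)]
    have hconv : ∀ (f : Fin K → ℝ) (c : ℝ), (∀ k, f k ≤ c) → ∑ k, lam k * f k ≤ c := by
      intro f c hf
      calc ∑ k, lam k * f k ≤ ∑ k, lam k * c :=
            Finset.sum_le_sum fun k _ => mul_le_mul_of_nonneg_left (hf k) (hlam0 k).le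
        _ = c := by rw [← Finset.sum_mul, hlam1, one_mul]
    refine ⟨fun j => ?_, fun i => ?_, fun i j => ⟨?_, ?_⟩⟩
    · refine le_of_mul_le_mul_left ?_ hT'
      simp only [Finset.mul_sum, hent]
      rw [Finset.sum_comm]
      simp only [← Finset.mul_sum]
      refine hconv _ _ fun k => ?_
      rw [Finset.sum_comm]
      exact (Finset.sum_le_sum fun t _ => (hM k t).2.2 j).trans_eq (by simp)
    · refine le_of_mul_le_mul_left ?_ hT'
      simp only [Finset.mul_sum, hent]
      rw [Finset.sum_comm]
      simp only [← Finset.mul_sum]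
      refine hconv _ _ fun k => ?_
      rw [Finset.sum_comm]
      exact (Finset.sum_le_sum fun t _ => (hM k t).2.1 i).trans_eq (by simp)
    · refine nonneg_of_mul_nonneg_right ?_ hT'
      rw [hent]
      exact Finset.sum_nonneg fun k _ => mul_nonneg (hlam0 k).le
        (Finset.sum_nonneg fun t _ => hM0 k t i j)
    · rw [le_div_iff₀' hT', hent]
      exact hconv _ _ fun k => hM1 k i j
end

section
/- Let N and T be positive integers and let Q = (Q_{i,j}) be an N×N matrix with nonnegative real entries. Then the maximum of Σ_{t=1}^{T} Σ_{i=1}^{N} Σ_{j=1}^{N} Q_{i,j} b^t_{i,j} over all families (b^1, …, b^T) of T pairwise disjoint N×N subpermutation matrices equals the maximum of Σ_{i=1}^{N} Σ_{j=1}^{N} Q_{i,j} c_{i,j} over all N×N matrices c with entries in {0,1} whose every row sum and every column sum is at most T. (Theorem 3: equivalence of the maximum-weight T-disjoint-matching ILP and the degree-constrained edge-selection ILP.) -/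
open Matrix BigOperators

/-- A natural-number matrix with all row and column sums equal to `s + 1` has a permutation
contained in its support. -/
lemma exists_perm_forall_apply_ne_zero {n : Type*} [Fintype n] [DecidableEq n] {s : ℕ}
    (A : n → n → ℕ) (hrow : ∀ i, ∑ j, A i j = s + 1) (hcol : ∀ j, ∑ i, A i j = s + 1) :
    ∃ σ : Equiv.Perm n, ∀ i, A i (σ i) ≠ 0 := by
  let f (i : n) : Finset n := {j | A i j ≠ 0}
  have hf (S : Finset n) : S.card ≤ (S.biUnion f).card := by
    refine Nat.le_of_mul_le_mul_right ?_ s.succ_pos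
    calc S.card * (s + 1) = ∑ i ∈ S, ∑ j, A i j := by simp [hrow]
      _ = ∑ i ∈ S, ∑ j ∈ S.biUnion f, A i j := by
        refine Finset.sum_congr rfl fun i hi => ?_
        refine (Finset.sum_subset (Finset.subset_univ _) fun j _ hj => ?_).symm
        by_contra h
        exact hj (Finset.mem_biUnion.2 ⟨i, hi, by simpa [f] using h⟩)
      _ ≤ ∑ i, ∑ j ∈ S.biUnion f, A i j := Finset.sum_le_univ_sum_of_nonneg fun _ => Nat.zero_le _
      _ = (S.biUnion f).card * (s + 1) := by rw [Finset.sum_comm]; simp [hcol]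
  obtain ⟨g, hg, hgf⟩ := (Finset.all_card_le_biUnion_card_iff_exists_injective f).1 hf
  exact ⟨Equiv.ofBijective g (Finite.injective_iff_bijective.1 hg), fun i => by
    simpa [f] using hgf i⟩

/-- A natural-number matrix with all row and column sums equal to `s` is a sum of `s` permutation
matrices. -/
lemma exists_perm_family_of_sum_eq {n : Type*} [Fintype n] [DecidableEq n] (s : ℕ)
    (A : n → n → ℕ) (hrow : ∀ i, ∑ j, A i j = s) (hcol : ∀ j, ∑ i, A i j = s) :
    ∃ σ : Fin s → Equiv.Perm n, ∀ i j, A i j = ∑ t, if σ t i = j then 1 else 0 := by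
  induction s generalizing A with
  | zero =>
    refine ⟨fun _ => 1, fun i j => ?_⟩
    simpa using Finset.sum_eq_zero_iff.1 (hrow i) j (Finset.mem_univ j)
  | succ s ih =>
    obtain ⟨τ, hτ⟩ := exists_perm_forall_apply_ne_zero A hrow hcol
    let B (i j : n) : ℕ := A i j - if τ i = j then 1 else 0
    have hB (i j : n) : A i j = B i j + if τ i = j then 1 else 0 := by
      by_cases h : τ i = j
      · have := hτ i
        subst h
        simp only [B, if_true]
        omega
      · simp [B, h]
    have hBrow (i : n) : ∑ j, B i j = s := by
      have := hrow i
      simpa [hB, Finset.sum_add_distrib] using this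
    have hBcol (j : n) : ∑ i, B i j = s := by
      have := hcol j
      simpa [hB, Finset.sum_add_distrib, ← Equiv.eq_symm_apply] using this
    obtain ⟨σ, hσ⟩ := ih B hBrow hBcol
    refine ⟨Fin.cons τ σ, fun i j => ?_⟩
    rw [hB, hσ, Fin.sum_univ_succ, add_comm]
    simp

/-- A natural-number matrix with all row and column sums at most `s` is the corner of one with all
row and column sums equal to `s`, hence a sum of `s` corners of permutation matrices. -/
lemma exists_perm_family_of_sum_le {n : Type*} [Fintype n] [DecidableEq n] (s : ℕ)
    (A : n → n → ℕ) (hrow : ∀ i, ∑ j, A i j ≤ s) (hcol : ∀ j, ∑ i, A i j ≤ s) :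
    ∃ σ : Fin s → Equiv.Perm (n ⊕ n),
      ∀ i j, A i j = ∑ t, if σ t (Sum.inl i) = Sum.inl j then 1 else 0 := by
  let C : Matrix (n ⊕ n) (n ⊕ n) ℕ := Matrix.fromBlocks (Matrix.of A)
    (Matrix.diagonal fun i => s - ∑ j, A i j) (Matrix.diagonal fun j => s - ∑ i, A i j)
    (Matrix.of A)ᵀ
  obtain ⟨σ, hσ⟩ := exists_perm_family_of_sum_eq s C
    (by
      rintro (i | j)
      · simp [C, Fintype.sum_sum_type, Matrix.diagonal_apply, hrow]
      · simp [C, Fintype.sum_sum_type, Matrix.diagonal_apply, hcol])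
    (by
      rintro (j | i)
      · simp [C, Fintype.sum_sum_type, Matrix.diagonal_apply, hcol]
      · simp [C, Fintype.sum_sum_type, Matrix.diagonal_apply, hrow])
  exact ⟨σ, fun i j => hσ (Sum.inl i) (Sum.inl j)⟩

/-- The corner of a permutation matrix is a subpermutation matrix. -/
lemma isSubpermutationMatrix_corner {N : ℕ} (σ : Equiv.Perm (Fin N ⊕ Fin N)) :
    IsSubpermutationMatrix
      (fun i j => if σ (Sum.inl i) = Sum.inl j then (1 : ℝ) else 0) := by
  refine ⟨fun i j => (ite_eq_or_eq _ _ _).symm, fun i => ?_, fun j => ?_⟩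
  · rw [Finset.sum_boole]
    exact_mod_cast Finset.card_le_one.2 fun a ha b hb => by
      simp only [Finset.mem_filter_univ] at ha hb
      exact Sum.inl_injective (ha.symm.trans hb)
  · rw [Finset.sum_boole]
    exact_mod_cast Finset.card_le_one.2 fun a ha b hb => by
      simp only [Finset.mem_filter_univ] at ha hb
      exact Sum.inl_injective (σ.injective (ha.trans hb.symm))

/-- A `{0,1}` matrix with row and column sums at most `T` is the sum of `T` pairwise disjoint
subpermutation matrices. -/
lemma exists_disjoint_subpermutation_family {N T : ℕ} (c : Matrix (Fin N) (Fin N) ℝ)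
    (hc : ∀ i j, c i j = 0 ∨ c i j = 1) (hrow : ∀ i, ∑ j, c i j ≤ (T : ℝ))
    (hcol : ∀ j, ∑ i, c i j ≤ (T : ℝ)) :
    ∃ b : Fin T → Matrix (Fin N) (Fin N) ℝ,
      (∀ t, IsSubpermutationMatrix (b t)) ∧
      (∀ t t', t ≠ t' → MatDisjoint (b t) (b t')) ∧ ∀ i j, c i j = ∑ t, b t i j := by
  have hnat (i j : Fin N) : ∃ a : ℕ, a ≤ 1 ∧ c i j = a := by
    rcases hc i j with h | h
    · exact ⟨0, by simp, by simp [h]⟩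
    · exact ⟨1, by simp, by simp [h]⟩
  choose A hA hcA using hnat
  obtain ⟨σ, hσ⟩ := exists_perm_family_of_sum_le T A
    (fun i => by exact_mod_cast (by simpa only [hcA] using hrow i : ∑ j, (A i j : ℝ) ≤ T))
    (fun j => by exact_mod_cast (by simpa only [hcA] using hcol j : ∑ i, (A i j : ℝ) ≤ T))
  refine ⟨_, fun t => isSubpermutationMatrix_corner (σ t), ?_, fun i j => ?_⟩
  · rintro t t' htt' i j ⟨h, h'⟩
    have hcard := hA i j
    rw [hσ, Finset.sum_boole] at hcard
    exact htt' (Finset.card_le_one.1 hcard t (by simpa using h) t' (by simpa using h'))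
  · rw [hcA, hσ]
    push_cast
    rfl

/-- The sum of pairwise disjoint `{0,1}` matrices is a `{0,1}` matrix. -/
lemma sum_eq_zero_or_one_of_matDisjoint {N T : ℕ} (b : Fin T → Matrix (Fin N) (Fin N) ℝ)
    (hb : ∀ t i j, b t i j = 0 ∨ b t i j = 1)
    (hdisj : ∀ t t', t ≠ t' → MatDisjoint (b t) (b t')) (i j : Fin N) :
    ∑ t, b t i j = 0 ∨ ∑ t, b t i j = 1 := by
  by_cases h : ∃ t, b t i j = 1
  · obtain ⟨t, ht⟩ := h
    right
    rw [Finset.sum_eq_single t, ht]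
    · exact fun t' _ hne => (hb t' i j).resolve_right fun h' => hdisj t' t hne i j ⟨h', ht⟩
    · simp
  · push Not at h
    exact Or.inl (Finset.sum_eq_zero fun t _ => (hb t i j).resolve_right (h t))

/-- Weighted sums over a family of matrices agree with the weighted sum of the total matrix. -/
lemma sum_weight_mul_family {N T : ℕ} (Q : Matrix (Fin N) (Fin N) ℝ)
    (b : Fin T → Matrix (Fin N) (Fin N) ℝ) :
    ∑ t, ∑ i, ∑ j, Q i j * b t i j = ∑ i, ∑ j, Q i j * ∑ t, b t i j := by
  rw [Finset.sum_comm]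
  refine Finset.sum_congr rfl fun i _ => ?_
  rw [Finset.sum_comm]
  simp only [Finset.mul_sum]

/-- There are finitely many `{0,1}` matrices. -/
lemma finite_zero_one_matrices (N : ℕ) :
    {c : Matrix (Fin N) (Fin N) ℝ | ∀ i j, c i j = 0 ∨ c i j = 1}.Finite := by
  have h : (Set.univ.pi fun _ : Fin N => Set.univ.pi fun _ : Fin N => ({0, 1} : Set ℝ)).Finite :=
    Set.Finite.pi fun _ => Set.Finite.pi fun _ => Set.toFinite _
  refine h.subset fun c hc => ?_
  simpa [Set.mem_pi] using fun i j => hc i j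

/-- Theorem 3: for nonnegative weights `Q`, the maximum of
`Σ_t Σ_i Σ_j Q_{i,j} b^t_{i,j}` over families of `T` pairwise disjoint subpermutation
matrices equals the maximum of `Σ_i Σ_j Q_{i,j} c_{i,j}` over `{0,1}` matrices `c` whose
every row sum and column sum is at most `T`. -/
theorem T_disjoint_matching_ILP_equivalence (N T : ℕ) (hN : 0 < N) (hT : 0 < T)
    (Q : Matrix (Fin N) (Fin N) ℝ) (hQ : ∀ i j, 0 ≤ Q i j) :
    ∃ v : ℝ,
      IsGreatest {x : ℝ | ∃ b : Fin T → Matrix (Fin N) (Fin N) ℝ,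
          (∀ t, IsSubpermutationMatrix (b t)) ∧
          (∀ t t', t ≠ t' → MatDisjoint (b t) (b t')) ∧
          x = ∑ t, ∑ i, ∑ j, Q i j * b t i j} v ∧
      IsGreatest {x : ℝ | ∃ c : Matrix (Fin N) (Fin N) ℝ,
          (∀ i j, c i j = 0 ∨ c i j = 1) ∧
          (∀ i, ∑ j, c i j ≤ (T : ℝ)) ∧ (∀ j, ∑ i, c i j ≤ (T : ℝ)) ∧
          x = ∑ i, ∑ j, Q i j * c i j} v := by
  let S : Set ℝ := {x : ℝ | ∃ c : Matrix (Fin N) (Fin N) ℝ,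
    (∀ i j, c i j = 0 ∨ c i j = 1) ∧
    (∀ i, ∑ j, c i j ≤ (T : ℝ)) ∧ (∀ j, ∑ i, c i j ≤ (T : ℝ)) ∧
    x = ∑ i, ∑ j, Q i j * c i j}
  have hfin : S.Finite := by
    refine ((finite_zero_one_matrices N).image fun c => ∑ i, ∑ j, Q i j * c i j).subset ?_
    rintro x ⟨c, hc, -, -, rfl⟩
    exact ⟨c, hc, rfl⟩
  have hne : S.Nonempty := ⟨0, 0, by simp, by simp, by simp, by simp⟩
  obtain ⟨v, hv⟩ := hfin.exists_maximal hne
  have hmax : IsGreatest S v := ⟨hv.1, fun x hx => (le_total x v).elim id fun h => hv.2 hx h⟩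
  refine ⟨v, ?_, hmax⟩
  convert hmax using 1
  ext x
  constructor
  · rintro ⟨b, hb, hdisj, rfl⟩
    refine ⟨fun i j => ∑ t, b t i j,
      sum_eq_zero_or_one_of_matDisjoint b (fun t => (hb t).1) hdisj, fun i => ?_, fun j => ?_,
      sum_weight_mul_family Q b⟩
    · rw [Finset.sum_comm]
      simpa using Finset.sum_le_sum fun t (_ : t ∈ Finset.univ) => (hb t).2.1 i
    · rw [Finset.sum_comm]
      simpa using Finset.sum_le_sum fun t (_ : t ∈ Finset.univ) => (hb t).2.2 j
  · rintro ⟨c, hc, hrow, hcol, rfl⟩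
    obtain ⟨b, hb, hdisj, hsum⟩ := exists_disjoint_subpermutation_family c hc hrow hcol
    exact ⟨b, hb, hdisj, by simp only [sum_weight_mul_family, hsum]⟩
end

section
/- Let R be the 3×3 matrix with rows (1/2, 2/5, 1/10), (2/5, 1/2, 1/10), (1/10, 1/10, 1/10). Then R is doubly substochastic with all entries in [0, 1/2], yet there exists no 3×3 doubly stochastic matrix R' with all entries in [0, 1/2] such that R_{i,j} ≤ R'_{i,j} for all i, j. (Counterexample showing that, unlike the unbounded case due to von Neumann, a 1/T-bounded doubly substochastic matrix need not be dominated entrywise by a 1/T-bounded doubly stochastic matrix.) -/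
open Matrix BigOperators

/-- The counterexample matrix `R`. -/
noncomputable def Rctr : Matrix (Fin 3) (Fin 3) ℝ :=
  !![1/2, 2/5, 1/10; 2/5, 1/2, 1/10; 1/10, 1/10, 1/10]

/-- `R` is doubly substochastic with all entries in `[0, 1/2]`, yet there is no
doubly stochastic `3×3` matrix `R'` with all entries in `[0, 1/2]` that dominates `R`
entrywise. -/
theorem no_bounded_doubly_stochastic_majorant :
    ((∀ i j, Rctr i j ∈ Set.Icc (0 : ℝ) (1 / 2)) ∧
      (∀ i, ∑ j, Rctr i j ≤ 1) ∧ (∀ j, ∑ i, Rctr i j ≤ 1)) ∧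
    ¬ ∃ R' : Matrix (Fin 3) (Fin 3) ℝ,
        (∀ i j, 0 ≤ R' i j) ∧
        (∀ i, ∑ j, R' i j = 1) ∧ (∀ j, ∑ i, R' i j = 1) ∧
        (∀ i j, R' i j ≤ 1 / 2) ∧
        (∀ i j, Rctr i j ≤ R' i j) := by
  refine ⟨⟨?_, ?_, ?_⟩, ?_⟩
  · intro i j
    fin_cases i <;> fin_cases j <;> norm_num [Rctr]
  · intro i
    fin_cases i <;> simp [Rctr, Fin.sum_univ_three] <;> norm_num
  · intro j
    fin_cases j <;> simp [Rctr, Fin.sum_univ_three] <;> norm_num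
  · rintro ⟨R', -, hrow, hcol, hle, hdom⟩
    have row := hrow 2
    have col₀ := hcol 0
    have col₁ := hcol 1
    have h₀₀ : 1 / 2 ≤ R' 0 0 := by simpa [Rctr] using hdom 0 0
    have h₁₀ : 2 / 5 ≤ R' 1 0 := by simpa [Rctr] using hdom 1 0
    have h₀₁ : 2 / 5 ≤ R' 0 1 := by simpa [Rctr] using hdom 0 1
    have h₁₁ : 1 / 2 ≤ R' 1 1 := by simpa [Rctr] using hdom 1 1
    have h₂₂ := hle 2 2
    rw [Fin.sum_univ_three] at row col₀ col₁
    linarith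
end

section
/- Let Q be the 3×3 matrix with rows (4, 4, 0), (4, 1, 4), (2, 1, 0), and let b̃^1 be the 3×3 subpermutation matrix with 1-entries exactly at positions (1,2), (2,3), (3,1). Then: (i) b̃^1 is a maximum-weight subpermutation matrix for Q, i.e., Σ_{i,j} Q_{i,j} b̃^1_{i,j} = 10 ≥ Σ_{i,j} Q_{i,j} b_{i,j} for every 3×3 subpermutation matrix b; and (ii) for every 3×3 subpermutation matrix b disjoint from b̃^1, Σ_{i,j} Q_{i,j} (b̃^1_{i,j} + b_{i,j}) ≤ 15 < 17, where 17 is the maximum of Σ_{i,j} Q_{i,j} (b^1_{i,j} + b^2_{i,j}) over all pairs of disjoint subpermutation matrices. (Hence the greedy iterative maximum-weight-matching algorithm is strictly suboptimal for the maximum-weight T-disjoint-matching problem.) -/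
open Matrix BigOperators

/-- The weight matrix `Q`. -/
def Qex : Matrix (Fin 3) (Fin 3) ℝ := !![4, 4, 0; 4, 1, 4; 2, 1, 0]

/-- The greedy first matching `b̃^1`, with 1-entries at `(1,2)`, `(2,3)`, `(3,1)`. -/
def bGreedy : Matrix (Fin 3) (Fin 3) ℝ := !![0, 1, 0; 0, 0, 1; 1, 0, 0]

theorem IsSubpermutationMatrix.nonneg {N : ℕ} {M : Matrix (Fin N) (Fin N) ℝ}
    (hM : IsSubpermutationMatrix M) (i j : Fin N) : 0 ≤ M i j := by
  rcases hM.1 i j with h | h <;> simp [h]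

theorem MatDisjoint.add_le_one {N : ℕ} {M M' : Matrix (Fin N) (Fin N) ℝ}
    (h : MatDisjoint M M') (hM : IsSubpermutationMatrix M) (hM' : IsSubpermutationMatrix M')
    (i j : Fin N) : M i j + M' i j ≤ 1 := by
  rcases hM.1 i j with h₁ | h₁ <;> rcases hM'.1 i j with h₂ | h₂
  · simp [h₁, h₂]
  · simp [h₁, h₂]
  · simp [h₁, h₂]
  · exact absurd ⟨h₁, h₂⟩ (h i j)

theorem isSubpermutationMatrix_bGreedy : IsSubpermutationMatrix bGreedy := by
  refine ⟨fun i j => ?_, fun i => ?_, fun j => ?_⟩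
  · fin_cases i <;> fin_cases j <;> simp [bGreedy]
  · fin_cases i <;> simp [bGreedy, Fin.sum_univ_three]
  · fin_cases j <;> simp [bGreedy, Fin.sum_univ_three]

theorem sum_Qex_mul (M : Matrix (Fin 3) (Fin 3) ℝ) :
    ∑ i, ∑ j, Qex i j * M i j =
      4 * M 0 0 + 4 * M 0 1 + 4 * M 1 0 + M 1 1 + 4 * M 1 2 + 2 * M 2 0 + M 2 1 := by
  simp [Qex, Fin.sum_univ_three]
  ring

/-- `b̃^1` is a maximum-weight subpermutation matrix for `Q` of weight `10`,
yet any subpermutation matrix `b` disjoint from `b̃^1` yields total weight at most `15`,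
strictly less than the maximum `17` over pairs of disjoint subpermutation matrices; hence
greedy iterative maximum-weight matching is strictly suboptimal. -/
theorem greedy_maximum_weight_matching_suboptimal :
    IsSubpermutationMatrix bGreedy ∧
    (∑ i, ∑ j, Qex i j * bGreedy i j) = 10 ∧
    (∀ b : Matrix (Fin 3) (Fin 3) ℝ, IsSubpermutationMatrix b →
      ∑ i, ∑ j, Qex i j * b i j ≤ 10) ∧
    (∀ b : Matrix (Fin 3) (Fin 3) ℝ, IsSubpermutationMatrix b → MatDisjoint bGreedy b →
      ∑ i, ∑ j, Qex i j * (bGreedy i j + b i j) ≤ 15) ∧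
    IsGreatest {x : ℝ | ∃ a b : Matrix (Fin 3) (Fin 3) ℝ,
        IsSubpermutationMatrix a ∧ IsSubpermutationMatrix b ∧ MatDisjoint a b ∧
        x = ∑ i, ∑ j, Qex i j * (a i j + b i j)} 17 ∧
    (15 : ℝ) < 17 := by
  have hg := isSubpermutationMatrix_bGreedy
  have hw : ∑ i, ∑ j, Qex i j * bGreedy i j = 10 := by
    rw [sum_Qex_mul]
    simp [bGreedy]
    norm_num
  refine ⟨hg, hw, fun b hb => ?_, fun b hb hd => ?_, ⟨?_, ?_⟩, by norm_num⟩
  · have hn := hb.nonneg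
    obtain ⟨-, hr, hc⟩ := hb
    simp only [Fin.sum_univ_three] at hr hc
    rw [sum_Qex_mul]
    linarith [hr 0, hr 1, hr 2, hc 0, hc 1, hc 2, hn 0 0, hn 0 1, hn 0 2, hn 1 0, hn 1 1,
      hn 1 2, hn 2 0, hn 2 1, hn 2 2]
  · have hn := hb.nonneg
    have hle := hd.add_le_one hg hb
    have h01 : b 0 1 ≤ 0 := by simpa [bGreedy] using hle 0 1
    have h12 : b 1 2 ≤ 0 := by simpa [bGreedy] using hle 1 2
    have h20 : b 2 0 ≤ 0 := by simpa [bGreedy] using hle 2 0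
    obtain ⟨-, hr, hc⟩ := hb
    simp only [Fin.sum_univ_three] at hr hc
    simp only [mul_add, Finset.sum_add_distrib]
    rw [hw, sum_Qex_mul]
    linarith [hr 0, hr 1, hr 2, hc 0, hc 1, hc 2, hn 0 0, hn 0 1, hn 0 2, hn 1 0, hn 1 1,
      hn 1 2, hn 2 0, hn 2 1, hn 2 2]
  · refine ⟨!![0, 1, 0; 1, 0, 0; 0, 0, 0], !![1, 0, 0; 0, 0, 1; 0, 1, 0],
      ⟨fun i j => ?_, fun i => ?_, fun j => ?_⟩, ⟨fun i j => ?_, fun i => ?_, fun j => ?_⟩,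
      fun i j => ?_, ?_⟩
    · fin_cases i <;> fin_cases j <;> simp
    · fin_cases i <;> simp [Fin.sum_univ_three]
    · fin_cases j <;> simp [Fin.sum_univ_three]
    · fin_cases i <;> fin_cases j <;> simp
    · fin_cases i <;> simp [Fin.sum_univ_three]
    · fin_cases j <;> simp [Fin.sum_univ_three]
    · fin_cases i <;> fin_cases j <;> simp
    · simp only [mul_add, Finset.sum_add_distrib]
      rw [sum_Qex_mul, sum_Qex_mul]
      simp
      norm_num
  · rintro x ⟨a, b, ha, hb, hd, rfl⟩
    have hna := ha.nonneg
    have hnb := hb.nonneg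
    have hle := hd.add_le_one ha hb
    obtain ⟨-, hra, hca⟩ := ha
    obtain ⟨-, hrb, hcb⟩ := hb
    simp only [Fin.sum_univ_three] at hra hca hrb hcb
    simp only [mul_add, Finset.sum_add_distrib]
    rw [sum_Qex_mul, sum_Qex_mul]
    linarith [hra 0, hra 1, hra 2, hca 0, hca 1, hca 2, hrb 0, hrb 1, hrb 2, hcb 0, hcb 1,
      hcb 2, hna 0 0, hna 0 1, hna 0 2, hna 1 0, hna 1 1, hna 1 2, hna 2 0, hna 2 1, hna 2 2,
      hnb 0 0, hnb 0 1, hnb 0 2, hnb 1 0, hnb 1 1, hnb 1 2, hnb 2 0, hnb 2 1, hnb 2 2,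
      hle 0 0, hle 0 1, hle 0 2, hle 1 0, hle 1 1, hle 1 2, hle 2 0, hle 2 1, hle 2 2]
end
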